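/- arXiv:1002.0619 — 2 statements merged into one kernel-verified Lean document; each statement's English description precedes it below -/
import Mathlib

section
/- (Burde's reciprocity law) Let p and q be distinct primes with p ≡ q ≡ 1 (mod 4) and (p/q) = 1. Write p = a² + b² and q = c² + d² with b, d even. Then (p/q)₄ · (q/p)₄ = ((ac − bd)/q). -/
/-- The rational quartic residue symbol `(m/p)₄ = m^((p−1)/4) mod p`, recorded as an
integer: it is `1` or `−1` when `m^((p−1)/4) = ±1` in `ZMod p`, and `0` otherwise. -/
def quarticSym (p : ℕ) (m : ℤ) : ℤ :=
  if (m : ZMod p) ^ ((p - 1) / 4) = 1 then 1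
  else if (m : ZMod p) ^ ((p - 1) / 4) = -1 then -1 else 0

theorem burde_uniq {p : ℕ} (hp : p.Prime) {a b u v : ℤ} (h1 : (p : ℤ) = a ^ 2 + b ^ 2)
    (h2 : (p : ℤ) = u ^ 2 + v ^ 2) (hb : Even b) (hv : Even v) (ha : Odd a) (hu : Odd u) :
    (u = a ∨ u = -a) ∧ (v = b ∨ v = -b) := by
  have hp0 : (p : ℤ) ≠ 0 := by exact_mod_cast hp.ne_zero
  have hpp : Prime (p : ℤ) := Nat.prime_iff_prime_int.mp hp
  have key : ∀ v : ℤ, (p : ℤ) = u ^ 2 + v ^ 2 → Even v → (p : ℤ) ∣ a * u - b * v →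
      u ^ 2 = a ^ 2 := by
    intro v h2 hv hd
    have hsq : (a * u - b * v) ^ 2 + (a * v + b * u) ^ 2 = (p : ℤ) ^ 2 := by
      rw [pow_two (p : ℤ)]; nth_rewrite 1 [h1]; rw [h2]; ring
    have hne : a * u - b * v ≠ 0 := by
      have : Odd (a * u - b * v) := (ha.mul hu).sub_even (hb.mul_right v)
      intro h; rw [h] at this; exact absurd this (by decide)
    obtain ⟨k, hk⟩ := hd
    have hk0 : k ≠ 0 := by rintro rfl; simp at hk; exact hne hk
    have hk1 : 1 ≤ k ^ 2 := by have := sq_pos_of_ne_zero hk0; omega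
    have h0 : (a * v + b * u) ^ 2 = 0 := by
      have h3 : (a * u - b * v) ^ 2 = p ^ 2 * k ^ 2 := by rw [hk]; ring
      nlinarith [sq_nonneg (a * v + b * u), sq_nonneg (p : ℤ)]
    have h0' : a * v + b * u = 0 := by simpa using h0
    have e : p * u = a * (a * u - b * v) := by
      have : (a^2+b^2) * u = a * (a * u - b * v) + b * (a * v + b * u) := by ring
      rw [h1, this, h0']; ring
    have e2 : (p:ℤ) ^ 2 * u ^ 2 = p ^ 2 * a ^ 2 := by
      have : (p:ℤ) ^ 2 * u ^ 2 = (p * u) ^ 2 := by ring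
      rw [this, e, mul_pow]
      have : (a * u - b * v) ^ 2 = p ^ 2 := by rw [h0'] at hsq; linarith
      rw [this]; ring
    exact mul_left_cancel₀ (pow_ne_zero 2 hp0) e2
  have hdvd : (p : ℤ) ∣ (a * u - b * v) * (a * u - b * (-v)) := by
    refine ⟨a ^ 2 - v ^ 2, ?_⟩
    have hu2 : u ^ 2 = p - v ^ 2 := by linarith
    have hb2 : b ^ 2 = p - a ^ 2 := by linarith
    have : (a * u - b * v) * (a * u - b * (-v)) = a ^ 2 * u ^ 2 - b ^ 2 * v ^ 2 := by ring
    rw [this, hu2, hb2]; ring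
  have hua : u ^ 2 = a ^ 2 := by
    rcases hpp.dvd_or_dvd hdvd with h | h
    · exact key v h2 hv h
    · exact key (-v) (by rw [h2]; ring) hv.neg h
  exact ⟨sq_eq_sq_iff_eq_or_eq_neg.mp hua, sq_eq_sq_iff_eq_or_eq_neg.mp (by linarith)⟩

theorem burde_I_prim : IsPrimitiveRoot (⟨0, 1⟩ : GaussianInt) 4 := by
  have : orderOf (⟨0, 1⟩ : GaussianInt) = 2 ^ 2 := by
    apply orderOf_eq_prime_pow <;> decide
  simpa [this] using IsPrimitiveRoot.orderOf (⟨0, 1⟩ : GaussianInt)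

theorem burde_char (p : ℕ) [Fact p.Prime] (hp4 : p % 4 = 1) :
    ∃ χ : MulChar (ZMod p) GaussianInt, χ ^ 4 = 1 ∧ (∃ u, χ u ^ 2 = -1) ∧
      Odd (jacobiSum χ χ).re ∧ Even (jacobiSum χ χ).im ∧
      (p : ℤ) = (jacobiSum χ χ).re ^ 2 + (jacobiSum χ χ).im ^ 2 := by
  have hdiv : 4 ∣ Fintype.card (ZMod p) - 1 := by rw [ZMod.card]; omega
  obtain ⟨χ, hχ⟩ := MulChar.exists_mulChar_orderOf (ZMod p) hdiv burde_I_prim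
  have h4 : χ ^ 4 = 1 := hχ ▸ pow_orderOf_eq_one χ
  have h2 : χ ^ 2 ≠ 1 := pow_ne_one_of_lt_orderOf (by norm_num) (by omega)
  have h1 : χ ≠ 1 := by rintro rfl; simp at h2
  have hodd : Odd (jacobiSum χ χ).re ∧ Even (jacobiSum χ χ).im := by
    obtain ⟨z, -, hz⟩ := exists_jacobiSum_eq_neg_one_add (by norm_num : 2 < 4) h4 h4 hdiv burde_I_prim
    have hI : ((⟨0, 1⟩ : GaussianInt) - 1) ^ 2 = ⟨0, -2⟩ := by decide
    rw [hz, hI]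
    constructor
    · refine ⟨z.im - 1, ?_⟩
      simp; ring
    · refine ⟨-z.re, ?_⟩
      simp; ring
  refine ⟨χ, h4, ?_, hodd.1, hodd.2, ?_⟩
  · by_contra! hc
    apply h2
    refine MulChar.ext fun u => ?_
    have h : (χ u ^ 2) ^ 2 = 1 := by
      rw [← pow_mul, ← MulChar.pow_apply_coe, h4, MulChar.one_apply_coe]
    rcases mul_self_eq_one_iff.mp ((pow_two _).symm.trans h) with h | h
    · rw [MulChar.pow_apply_coe, h, MulChar.one_apply_coe]
    · exact absurd h (hc _)
  · have hinj : Function.Injective GaussianInt.toComplex := fun x y h => GaussianInt.toComplex_inj.mp h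
    set χ' := χ.ringHomComp GaussianInt.toComplex with hχ'
    have a1 : χ' ≠ 1 := (MulChar.ringHomComp_ne_one_iff hinj).mpr h1
    have a2 : χ' * χ' ≠ 1 := by
      rw [← MulChar.ringHomComp_mul, ← pow_two]
      exact (MulChar.ringHomComp_ne_one_iff hinj).mpr h2
    have hJ := jacobiSum_mul_jacobiSum_inv (F := ZMod p) (F' := ℂ) (by
      rw [ZMod.ringChar_zmod_n, ringChar.eq_zero]; exact (Fact.out : p.Prime).ne_zero.symm) a1 a1 a2
    have hst : jacobiSum χ'⁻¹ χ'⁻¹ = (starRingEnd ℂ) (jacobiSum χ' χ') := by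
      rw [← jacobiSum_ringHomComp, ← MulChar.star_eq_inv]; rfl
    rw [hst, jacobiSum_ringHomComp, Complex.mul_conj, ZMod.card, Complex.normSq_apply] at hJ
    rw [← GaussianInt.intCast_re, ← GaussianInt.intCast_im] at hJ
    have : (((jacobiSum χ χ).re * (jacobiSum χ χ).re + (jacobiSum χ χ).im * (jacobiSum χ χ).im : ℤ) : ℂ) = ((p : ℤ) : ℂ) := by
      push_cast at hJ ⊢; exact hJ
    have := Int.cast_injective this
    rw [← this]; ring

theorem burde_gauss {p q : ℕ} [Fact p.Prime] [Fact q.Prime] (hne : p ≠ q)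
    (hq4 : q % 4 = 1) (χ : MulChar (ZMod p) GaussianInt)
    (h4 : χ ^ 4 = 1) (hu : ∃ u, χ u ^ 2 = -1) (φ : GaussianInt →+* ZMod q) :
    φ (χ q) * (φ (jacobiSum χ χ) ^ (q / 2) * (p : ZMod q) ^ ((q - 1) / 4)) = 1 := by
  have hrc : ringChar (ZMod q) ≠ ringChar (ZMod p) := by
    simpa [ZMod.ringChar_zmod_n] using hne.symm
  let ψ := AddChar.FiniteField.primitiveChar (ZMod p) (ZMod q) hrc
  let F := CyclotomicField ψ.n (ZMod q)
  have : CharP F q := charP_of_injective_algebraMap (algebraMap (ZMod q) F).injective q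
  let f : GaussianInt →+* F := (algebraMap (ZMod q) F).comp φ
  set χ' := χ.ringHomComp f with hχ'
  have hq2 : 2 < q := by have := (Fact.out : q.Prime).two_le; omega
  have : Fact (2 < q) := ⟨hq2⟩
  have h4' : χ' ^ 4 = 1 := by rw [hχ', MulChar.ringHomComp_pow, h4, MulChar.ringHomComp_one]
  have h2' : χ' ^ 2 ≠ 1 := by
    obtain ⟨u, hu⟩ := hu
    have hu0 : IsUnit u := by
      by_contra h
      rw [MulChar.map_nonunit _ h] at hu
      exact absurd hu (by decide)
    intro h
    have e := congrArg (fun g => g u) h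
    simp only [MulChar.pow_apply' _ two_ne_zero, hχ', MulChar.ringHomComp_apply,
      ← map_pow, hu, MulChar.one_apply hu0] at e
    rw [map_neg, map_one] at e
    exact Ring.neg_one_ne_one_of_char_ne_two (by rw [ringChar.eq F q]; omega) e
  have h1' : χ' ≠ 1 := by intro h; rw [h] at h2'; simp at h2'
  have hquad : (χ' ^ 2).IsQuadratic := by
    intro x
    by_cases hx : IsUnit x
    · have : ((χ' ^ 2) x) ^ 2 = 1 := by
        rw [← MulChar.pow_apply' _ two_ne_zero, ← pow_mul, h4', MulChar.one_apply hx]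
      right; exact mul_self_eq_one_iff.mp ((pow_two _).symm.trans this)
    · left; exact MulChar.map_nonunit _ hx
  have hqu : IsUnit (q : ZMod p) := by
    rw [ZMod.isUnit_iff_coprime]
    exact (Nat.coprime_primes Fact.out Fact.out).mpr hne.symm
  have hS := gaussSum_sq h2' hquad ψ.prim
  have hm1 : (χ' ^ 2) (-1) = 1 := by
    rw [MulChar.pow_apply' _ two_ne_zero, ← map_pow]; simp
  rw [hm1, one_mul, ZMod.card] at hS
  have hcard : ((Fintype.card (ZMod p) : ℕ) : F) ≠ 0 := by
    rw [ZMod.card, Ne, CharP.cast_eq_zero_iff F q, Nat.prime_dvd_prime_iff_eq Fact.out Fact.out]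
    exact hne.symm
  have hG0 := gaussSum_ne_zero_of_nontrivial hcard h1' ψ.prim
  have hG2 : gaussSum (χ' ^ 2) ψ.char * f (jacobiSum χ χ) = gaussSum χ' ψ.char ^ 2 := by
    rw [← jacobiSum_ringHomComp, pow_two, pow_two]
    exact jacobiSum_mul_nontrivial (by rwa [← pow_two]) _
  have hfr := gaussSum_frob q χ' ψ.char
  have hχq : χ' ^ q = χ' := by
    obtain ⟨k, hk⟩ : ∃ k, q = 4 * k + 1 := ⟨q / 4, by omega⟩
    calc χ' ^ q = χ' ^ (4 * k + 1) := congrArg (fun n => χ' ^ n) hk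
      _ = χ' := by rw [pow_succ, pow_mul, h4', one_pow, one_mul]
  have hψq : ψ.char ^ q = AddChar.mulShift ψ.char (hqu.unit : ZMod p) := by
    rw [IsUnit.unit_spec, AddChar.pow_mulShift]
  rw [hχq, hψq] at hfr
  have hms := gaussSum_mulShift χ' ψ.char hqu.unit
  rw [← hfr, IsUnit.unit_spec] at hms
  have hq1 : q = 2 * (q / 2) + 1 := by omega
  have hq3 : q / 2 = 2 * ((q - 1) / 4) := by omega
  have e1 : gaussSum χ' ψ.char ^ q = f (jacobiSum χ χ) ^ (q / 2) * (p : F) ^ ((q - 1) / 4) * gaussSum χ' ψ.char := by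
    refine (congrArg (fun n => gaussSum χ' ψ.char ^ n) hq1).trans ?_
    rw [pow_succ, pow_mul, ← hG2, mul_pow]
    congr 1
    rw [mul_comm]
    congr 1
    refine (congrArg (fun n => gaussSum (χ' ^ 2) ψ.char ^ n) hq3).trans ?_
    rw [pow_mul, hS]
  rw [e1, ← mul_assoc] at hms
  have := mul_right_cancel₀ hG0 (hms.trans (one_mul _).symm)
  apply (algebraMap (ZMod q) F).injective
  simpa [f, hχ'] using this

theorem burde_quart {p q : ℕ} [Fact p.Prime] (hp4 : p % 4 = 1) (hq0 : (q : ZMod p) ≠ 0)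
    (hsq : IsSquare (q : ZMod p)) (χ : MulChar (ZMod p) GaussianInt)
    (h4 : χ ^ 4 = 1) (hu : ∃ u, χ u ^ 2 = -1) :
    ((q : ZMod p) ^ ((p - 1) / 4) = 1 ∧ χ q = 1) ∨ ((q : ZMod p) ^ ((p - 1) / 4) = -1 ∧ χ q = -1) := by
  have hfour : ∀ t : ZMod p, t ≠ 0 → χ t ^ 4 = 1 := by
    intro t ht
    rw [← MulChar.pow_apply' _ (by norm_num), h4, MulChar.one_apply (isUnit_iff_ne_zero.mpr ht)]
  have hsq1 : ∀ t : ZMod p, t ≠ 0 → IsSquare t → χ t ^ 2 = 1 := by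
    rintro t ht ⟨r, rfl⟩
    have hr : r ≠ 0 := by rintro rfl; simp at ht
    rw [map_mul, ← hfour r hr]; ring
  obtain ⟨s, hs⟩ := hsq
  have hs0 : s ≠ 0 := by rintro rfl; simp at hs; exact hq0 hs
  have hpow : (q : ZMod p) ^ ((p - 1) / 4) = s ^ (p / 2) := by
    rw [hs, ← pow_two, ← pow_mul]; congr 1; omega
  have hχ : χ q = χ s ^ 2 := by rw [hs, map_mul, pow_two]
  rw [hpow, hχ]
  by_cases h : IsSquare s
  · left; exact ⟨(ZMod.euler_criterion p hs0).mp h, hsq1 s hs0 h⟩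
  · right
    have hs1 : s ^ (p / 2) = -1 :=
      (ZMod.pow_div_two_eq_neg_one_or_one p hs0).resolve_left
        fun h' => h ((ZMod.euler_criterion p hs0).mpr h')
    refine ⟨hs1, ?_⟩
    obtain ⟨u, hu⟩ := hu
    have hu0 : u ≠ 0 := by
      rintro rfl
      rw [MulChar.map_zero] at hu
      exact absurd hu (by decide)
    have hnu : u ^ (p / 2) = -1 := by
      refine (ZMod.pow_div_two_eq_neg_one_or_one p hu0).resolve_left fun h' => ?_
      have := hsq1 u hu0 ((ZMod.euler_criterion p hu0).mpr h')
      rw [hu] at this; exact absurd this (by decide)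
    have : χ (s * u) ^ 2 = 1 := by
      refine hsq1 _ (mul_ne_zero hs0 hu0) ((ZMod.euler_criterion p (mul_ne_zero hs0 hu0)).mpr ?_)
      rw [mul_pow, hs1, hnu]; ring
    rw [map_mul, mul_pow, hu] at this
    linear_combination -this

theorem burde_leg_c {q : ℕ} [Fact q.Prime] (hq4 : q % 4 = 1) {c d : ℤ}
    (hq : (q : ℤ) = c ^ 2 + d ^ 2) (hc : Odd c) (hqc : ¬ (q : ℤ) ∣ c) : legendreSym q c = 1 := by
  have hm1 : legendreSym q (-1) = 1 := by
    rw [legendreSym.at_neg_one (by omega)]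
    exact ZMod.χ₄_nat_one_mod_four hq4
  have habs : legendreSym q c = legendreSym q (c.natAbs : ℤ) := by
    rcases Int.natAbs_eq c with h | h
    · rw [← h]
    · conv_lhs => rw [h, neg_eq_neg_one_mul, legendreSym.mul, hm1, one_mul]
  have hodd : Odd c.natAbs := Int.natAbs_odd.mpr hc
  have hgcd : IsCoprime d c := by
    have hpp : Prime (q : ℤ) := Nat.prime_iff_prime_int.mp Fact.out
    have h1 : IsCoprime (q : ℤ) c := (Prime.coprime_iff_not_dvd hpp).mpr hqc
    have h2 : IsCoprime (d ^ 2) c := by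
      have : (q : ℤ) = d ^ 2 + c * c := by rw [hq]; ring
      rw [this] at h1
      exact IsCoprime.of_add_mul_left_left h1
    exact (IsCoprime.pow_left_iff (by norm_num)).mp h2
  rw [habs, jacobiSym.legendreSym.to_jacobiSym, jacobiSym.quadratic_reciprocity_one_mod_four' hodd hq4]
  have hmod : (q : ℤ) ≡ d ^ 2 [ZMOD (c.natAbs : ℤ)] := by
    refine (Int.modEq_iff_dvd.mpr ?_).symm
    rw [hq, Int.natAbs_dvd]; exact ⟨c, by ring⟩
  rw [jacobiSym.mod_left' hmod]
  apply jacobiSym.sq_one'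
  rw [Int.isCoprime_iff_gcd_eq_one] at hgcd
  simpa [Int.gcd, Int.natAbs_abs] using hgcd

/-- Burde's reciprocity law: let `p ≠ q` be primes `≡ 1 (mod 4)` with
`(p/q) = 1`.  Write `p = a² + b²`, `q = c² + d²` with `b, d` even.  Then
`(p/q)₄·(q/p)₄ = ((ac − bd)/q)`. -/
theorem burde (p q : ℕ) [Fact p.Prime] [Fact q.Prime] (hne : p ≠ q)
    (hp4 : p % 4 = 1) (hq4 : q % 4 = 1) (hpq : legendreSym q p = 1)
    (a b c d : ℤ) (hp : (p : ℤ) = a ^ 2 + b ^ 2) (hq : (q : ℤ) = c ^ 2 + d ^ 2)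
    (hb : Even b) (hd : Even d) :
    quarticSym q (p : ℤ) * quarticSym p (q : ℤ) = legendreSym q (a * c - b * d) := by
  have hoddaux : ∀ n : ℕ, n % 4 = 1 → ∀ x y : ℤ, (n : ℤ) = x ^ 2 + y ^ 2 → Even y → Odd x := by
    intro n hn x y h hy
    by_contra hx
    rw [Int.not_odd_iff_even] at hx
    have h1 : Even (n : ℤ) := by
      rw [h]; exact (hx.pow_of_ne_zero two_ne_zero).add (hy.pow_of_ne_zero two_ne_zero)
    have h2 : Even n := by exact_mod_cast h1
    rw [Nat.even_iff] at h2; omega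
  have ha : Odd a := hoddaux p hp4 a b hp hb
  have hc : Odd c := hoddaux q hq4 c d hq hd
  have hq2 : 2 < q := by have := (Fact.out : q.Prime).two_le; omega
  have : Fact (2 < q) := ⟨hq2⟩
  have : Fact (2 < p) := ⟨by have := (Fact.out : p.Prime).two_le; omega⟩
  have hq0 : (q : ZMod p) ≠ 0 := by
    rw [Ne, ZMod.natCast_eq_zero_iff, Nat.prime_dvd_prime_iff_eq Fact.out Fact.out]; exact hne
  have hp0 : (p : ZMod q) ≠ 0 := by
    rw [Ne, ZMod.natCast_eq_zero_iff, Nat.prime_dvd_prime_iff_eq Fact.out Fact.out]; exact hne.symm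
  have hqp : legendreSym p q = 1 := by
    rw [legendreSym.quadratic_reciprocity_one_mod_four hq4 (by omega)]; exact hpq
  have hsq : IsSquare (q : ZMod p) := by
    have := (legendreSym.eq_one_iff' p hq0).mp hqp
    exact this
  have hqc : ¬ (q : ℤ) ∣ c := by
    intro h
    have h0 : c ≠ 0 := by rintro rfl; exact absurd hc (by decide)
    have h1 := Int.le_of_dvd (abs_pos.mpr h0) ((dvd_abs _ _).mpr h)
    have h2 : |c| ^ 2 = c ^ 2 := sq_abs c
    have : (2 : ℤ) < q := by exact_mod_cast hq2
    nlinarith [sq_nonneg d]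
  have hc0 : (c : ZMod q) ≠ 0 := by rwa [Ne, ZMod.intCast_zmod_eq_zero_iff_dvd]
  have hlc := burde_leg_c hq4 hq hc hqc
  have hm1 : legendreSym q (-1) = 1 := by
    rw [legendreSym.at_neg_one (by omega)]
    exact ZMod.χ₄_nat_one_mod_four hq4
  have hcd : (c : ZMod q) ^ 2 + (d : ZMod q) ^ 2 = 0 := by
    have := congrArg (Int.cast : ℤ → ZMod q) hq
    push_cast at this
    rw [← this]; simp
  have hI : ((d : ZMod q) / c) * ((d : ZMod q) / c) = ((-1 : ℤ) : ZMod q) := by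
    field_simp
    push_cast
    linear_combination hcd
  obtain ⟨χ, h4, hu, hJo, hJe, hJn⟩ := burde_char p hp4
  set φ : GaussianInt →+* ZMod q := Zsqrtd.lift ⟨(d : ZMod q) / c, hI⟩ with hφ
  have hG := burde_gauss hne hq4 χ h4 hu φ
  have hQ := burde_quart hp4 hq0 hsq χ h4 hu
  set J := jacobiSum χ χ with hJdef
  have hφJ : φ J = J.re + J.im * ((d : ZMod q) / c) := by simp [hφ, Zsqrtd.lift]
  -- the Legendre symbol
  have hL : ((legendreSym q (J.re * c + J.im * d) : ℤ) : ZMod q) = φ J ^ (q / 2) := by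
    have e : ((J.re * c + J.im * d : ℤ) : ZMod q) = c * φ J := by
      rw [hφJ]; push_cast; field_simp
    have hc1 := legendreSym.eq_pow q c
    rw [hlc] at hc1
    rw [legendreSym.eq_pow, e, mul_pow, ← hc1]; simp
  have hneg : ∀ x : ℤ, legendreSym q (-x) = legendreSym q x := by
    intro x; rw [neg_eq_neg_one_mul, legendreSym.mul, hm1, one_mul]
  have hprod : legendreSym q (a * c + b * d) * legendreSym q (a * c - b * d) = 1 := by
    have e : (((a * c + b * d) * (a * c - b * d) : ℤ) : ZMod q) = ((p * (c * c) : ℤ) : ZMod q) := by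
      rw [hp]; push_cast
      linear_combination (-(b : ZMod q) ^ 2) * hcd
    rw [← legendreSym.mul, legendreSym, e, ← legendreSym, legendreSym.mul, legendreSym.mul, hpq, hlc]
    rfl
  have hpm : legendreSym q (a * c + b * d) = legendreSym q (a * c - b * d) := by
    rcases Int.eq_one_or_neg_one_of_mul_eq_one' hprod with h | h <;> rw [h.1, h.2]
  have hLeq : legendreSym q (J.re * c + J.im * d) = legendreSym q (a * c - b * d) := by
    obtain ⟨h1 | h1, h2 | h2⟩ := burde_uniq Fact.out hp hJn hb hJe ha hJo <;> rw [h1, h2]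
    · exact hpm
    · congr 1; ring
    · rw [← hneg]; congr 1; ring
    · rw [← hpm, ← hneg]; congr 1; ring
  rw [hLeq] at hL
  rw [← hL] at hG
  have hLpm : legendreSym q (a * c - b * d) = 1 ∨ legendreSym q (a * c - b * d) = -1 := by
    rcases Int.eq_one_or_neg_one_of_mul_eq_one' hprod with h | h <;> simp [h.2]
  have hnp : (-1 : ZMod p) ≠ 1 := ZMod.neg_one_ne_one
  have hnq : (-1 : ZMod q) ≠ 1 := ZMod.neg_one_ne_one
  unfold quarticSym
  simp only [Int.cast_natCast]
  rcases hQ with ⟨h1, h2⟩ | ⟨h1, h2⟩ <;> rcases hLpm with h3 | h3 <;>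
    rw [h2, h3] at hG <;> rw [h1, h3] <;> simp [hnp] at hG ⊢
  · rw [hG]; simp
  · rw [show (p : ZMod q) ^ ((q - 1) / 4) = -1 by linear_combination -hG]; simp [hnq]
  · rw [show (p : ZMod q) ^ ((q - 1) / 4) = -1 by linear_combination -hG]; simp [hnq]
  · rw [hG]; simp
end

section
/- (Scholz's reciprocity law) Let p ≡ q ≡ 1 (mod 4) be distinct primes with (p/q) = 1, and let ε = t + u√p ∈ ℤ[√p] be a unit of norm −1, i.e. t² − p·u² = −1. Then the Legendre symbol ((t + u√p)/q) equals (p/q)₄·(q/p)₄, where √p is interpreted as a square root of p mod q. -/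
theorem prim_i : IsPrimitiveRoot (⟨0,1⟩ : GaussianInt) 4 := by
  apply IsPrimitiveRoot.of_map_of_injective (f := GaussianInt.toComplex) _ GaussianInt.toComplex_injective
  have := Complex.isPrimitiveRoot_exp 4 (by norm_num)
  have h : GaussianInt.toComplex ⟨0,1⟩ = Complex.I := by
    rw [GaussianInt.toComplex_def']; simp
  rw [h]
  convert this using 1
  rw [show 2 * (Real.pi:ℂ) * Complex.I / (4:ℕ) = Real.pi / 2 * Complex.I by push_cast; ring]
  rw [Complex.exp_pi_div_two_mul_I]

theorem exists_char (p : ℕ) [Fact p.Prime] (hp4 : p % 4 = 1) :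
    ∃ χ : MulChar (ZMod p) GaussianInt, orderOf χ = 4 := by
  apply MulChar.exists_mulChar_orderOf (ZMod p) _ prim_i
  rw [ZMod.card]; omega

theorem jac_parity (p : ℕ) [Fact p.Prime] (hp4 : p % 4 = 1)
    (χ : MulChar (ZMod p) GaussianInt) (hχ : orderOf χ = 4) :
    (jacobiSum χ χ).re % 2 = 1 ∧ (jacobiSum χ χ).im % 2 = 0 := by
  have h4 : χ ^ 4 = 1 := hχ ▸ pow_orderOf_eq_one χ
  obtain ⟨z, -, hz⟩ := exists_jacobiSum_eq_neg_one_add (n := 4) (by norm_num) h4 h4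
    (by rw [ZMod.card]; omega) prim_i
  rw [hz]
  simp [pow_two]
  try omega

theorem jac_norm (p : ℕ) [Fact p.Prime]
    (χ : MulChar (ZMod p) GaussianInt) (hχ : orderOf χ = 4) :
    jacobiSum χ χ * star (jacobiSum χ χ) = (p : GaussianInt) := by
  have h1 : χ ≠ 1 := by rintro rfl; simp at hχ
  have h2 : χ * χ ≠ 1 := by
    intro h
    have := orderOf_dvd_of_pow_eq_one (n := 2) (x := χ) (by rw [pow_two, h])
    rw [hχ] at this; norm_num at this
  apply GaussianInt.toComplex_injective
  set f := GaussianInt.toComplex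
  have hf := GaussianInt.toComplex_injective
  have g1 : χ.ringHomComp f ≠ 1 := (MulChar.ringHomComp_ne_one_iff hf).mpr h1
  have g2 : χ.ringHomComp f * χ.ringHomComp f ≠ 1 := by
    rw [← MulChar.ringHomComp_mul]
    exact (MulChar.ringHomComp_ne_one_iff hf).mpr h2
  have key := jacobiSum_mul_jacobiSum_inv (F := ZMod p) (F' := ℂ) (by
    rw [ringChar.eq_zero, ZMod.ringChar_zmod_n]; exact (Fact.out : p.Prime).ne_zero.symm) g1 g1 g2
  rw [map_mul, map_natCast, GaussianInt.toComplex_star, ← jacobiSum_ringHomComp]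
  rw [ZMod.card] at key
  rw [← key]
  congr 1
  simp only [jacobiSum, map_sum, map_mul]
  refine Finset.sum_congr rfl fun x _ => ?_
  rw [← MulChar.star_apply', ← MulChar.star_apply']; rfl

theorem char_val (p : ℕ) [Fact p.Prime] (hp4 : p % 4 = 1)
    (χ : MulChar (ZMod p) GaussianInt) (hχ : orderOf χ = 4) (a : ZMod p) (ha : a ≠ 0)
    (hs : IsSquare a) :
    (a ^ ((p-1)/4) = 1 ∧ χ a = 1) ∨ (a ^ ((p-1)/4) = -1 ∧ χ a = -1) := by
  have h4 : χ ^ 4 = 1 := hχ ▸ pow_orderOf_eq_one χ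
  have hv : ∀ x : ZMod p, x ≠ 0 → χ x ^ 4 = 1 := by
    intro x hx
    rw [← MulChar.pow_apply' _ (by norm_num), h4, MulChar.one_apply (isUnit_iff_ne_zero.mpr hx)]
  obtain ⟨r, rfl⟩ := hs
  have hr : r ≠ 0 := by rintro rfl; simp at ha
  have e : (r*r) ^ ((p-1)/4) = r ^ (p/2) := by
    rw [← pow_two, ← pow_mul]; congr 1; omega
  rw [e]
  by_cases hsq : IsSquare r
  · left
    refine ⟨(ZMod.euler_criterion p hr).mp hsq, ?_⟩
    obtain ⟨w, rfl⟩ := hsq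
    have := hv w (by rintro rfl; simp at hr)
    rw [← this]; simp only [map_mul]; ring
  · right
    have h1 : r ^ (p/2) = -1 := by
      rcases ZMod.pow_div_two_eq_neg_one_or_one p hr with h | h
      · exact absurd ((ZMod.euler_criterion p hr).mpr h) hsq
      · exact h
    refine ⟨h1, ?_⟩
    have h2 := hv r hr
    have h3 : (χ (r*r) - 1) * (χ (r*r) + 1) = 0 := by
      rw [map_mul]; linear_combination h2
    rcases mul_eq_zero.mp h3 with h | h
    · exfalso
      have hrr : χ r ^ 2 = 1 := by rw [map_mul] at h; linear_combination h
      have : χ ^ 2 = 1 := by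
        refine MulChar.ext fun x => ?_
        rw [MulChar.one_apply_coe, MulChar.pow_apply' _ (by norm_num)]
        have hx := x.ne_zero
        by_cases hxs : IsSquare (x : ZMod p)
        · obtain ⟨w, hw⟩ := hxs
          have := hv w (by rintro rfl; simp at hw)
          rw [hw, map_mul]; rw [← this]; ring
        · have hx1 : (x:ZMod p) ^ (p/2) = -1 := by
            rcases ZMod.pow_div_two_eq_neg_one_or_one p hx with h | h
            · exact absurd ((ZMod.euler_criterion p hx).mpr h) hxs
            · exact h
          have : IsSquare ((x:ZMod p) * r) := by
            rw [ZMod.euler_criterion p (mul_ne_zero hx hr), mul_pow, hx1, h1]; norm_num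
          obtain ⟨w, hw⟩ := this
          have h5 := hv w (by rintro rfl; simp [hr] at hw)
          have h6 : χ x * χ r = χ w * χ w := by rw [← map_mul, ← map_mul, hw]
          have : (χ x * χ r)^2 = 1 := by rw [h6, ← h5]; ring
          rw [mul_pow, hrr, mul_one] at this
          exact this
      have := orderOf_dvd_of_pow_eq_one this
      rw [hχ] at this; norm_num at this
    · linear_combination h

theorem gauss_part (p q : ℕ) [Fact p.Prime] [Fact q.Prime] (hne : p ≠ q)
    (hp4 : p % 4 = 1) (hq4 : q % 4 = 1)
    (χ : MulChar (ZMod p) GaussianInt) (hχ : orderOf χ = 4)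
    (φ : GaussianInt →+* ZMod q) (s : ℤ) (hs : s = 1 ∨ s = -1) (hsχ : χ (q : ZMod p) = s)
    (ρ : ZMod q) (hρ : ρ ^ 2 = (p : ZMod q)) :
    (φ (jacobiSum χ χ)) ^ (q/2) * (p : ZMod q) ^ ((q-1)/4) = s := by
  have h4 : χ ^ 4 = 1 := hχ ▸ pow_orderOf_eq_one χ
  have h2 : χ ^ 2 ≠ 1 := by
    intro h
    have := orderOf_dvd_of_pow_eq_one h
    rw [hχ] at this; norm_num at this
  have hpq0 : (p : ZMod q) ≠ 0 := by
    rw [Ne, ZMod.natCast_eq_zero_iff]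
    rw [Nat.prime_dvd_prime_iff_eq Fact.out Fact.out]; exact hne.symm
  have hqp0 : (q : ZMod p) ≠ 0 := by
    rw [Ne, ZMod.natCast_eq_zero_iff]
    rw [Nat.prime_dvd_prime_iff_eq Fact.out Fact.out]; exact hne
  let E := AlgebraicClosure (ZMod q)
  haveI : CharP E q := charP_of_injective_algebraMap (algebraMap (ZMod q) E).injective q
  have hpE : (p : E) ≠ 0 := by
    have := (map_ne_zero (algebraMap (ZMod q) E)).mpr hpq0
    simpa using this
  haveI : NeZero (p : E) := ⟨hpE⟩
  obtain ⟨ζ, hζ⟩ := (HasEnoughRootsOfUnity.exists_primitiveRoot E p)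
  let ψ : AddChar (ZMod p) E := AddChar.zmodChar p hζ.pow_eq_one
  have hψ : ψ.IsPrimitive := AddChar.zmodChar_primitive_of_primitive_root p hζ
  let f : GaussianInt →+* E := (algebraMap (ZMod q) E).comp φ
  let X := χ.ringHomComp f
  have hX4 : X ^ 4 = 1 := by
    show (χ.ringHomComp f)^4 = 1
    rw [MulChar.ringHomComp_pow, h4, MulChar.ringHomComp_one]
  have h2E : (2:E) ≠ 0 := by
    intro h
    have h' : ((2:ℕ):E) = 0 := by exact_mod_cast h
    rw [CharP.cast_eq_zero_iff E q] at h'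
    have := Nat.le_of_dvd (by norm_num) h'
    have := (Fact.out : q.Prime).two_le
    omega
  have hX2 : X ^ 2 ≠ 1 := by
    intro h
    apply h2
    refine MulChar.ext fun x => ?_
    rw [MulChar.one_apply_coe]
    have hv : (χ ^ 2) x * (χ^2) x= 1 := by
      rw [← MulChar.mul_apply, ← pow_add, h4, MulChar.one_apply_coe]
    have hv' : ((χ ^ 2) x - 1) * ((χ^2) x + 1) = 0 := by linear_combination hv
    rcases mul_eq_zero.mp hv' with h' | h'
    · linear_combination h'
    · exfalso
      have e : (X^2) x = 1 := by rw [h, MulChar.one_apply_coe]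
      have e2 : (X^2) x = f ((χ^2) x) := by
        show ((χ.ringHomComp f)^2) x = _
        rw [MulChar.ringHomComp_pow]; rfl
      have e3 : (χ^2) x = -1 := by linear_combination h'
      rw [e2, e3, map_neg, map_one] at e
      exact h2E (by linear_combination -e)
  have hX1 : X ≠ 1 := by intro h; exact hX2 (by rw [h, one_pow])
  have hXX : X * X ≠ 1 := by rw [← pow_two]; exact hX2
  have hquad : (X^2).IsQuadratic := by
    intro a
    by_cases ha : a = 0
    · left; rw [ha]; exact MulChar.map_zero _
    · right
      have hv : (X ^ 2) a * (X^2) a = 1 := by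
        rw [← MulChar.mul_apply, ← pow_add, hX4, MulChar.one_apply (isUnit_iff_ne_zero.mpr ha)]
      exact mul_self_eq_one_iff.mp hv
  set G := gaussSum X ψ with hG
  set g := gaussSum (X^2) ψ with hg
  have hJ : g * f (jacobiSum χ χ) = G ^ 2 := by
    rw [pow_two, ← jacobiSum_mul_nontrivial hXX ψ, ← pow_two, jacobiSum_ringHomComp]
  have hg2 : g ^ 2 = p := by
    rw [hg, gaussSum_sq hX2 hquad hψ, ZMod.card, MulChar.pow_apply' _ (by norm_num), ← map_pow]
    simp
  have hG0 : G ≠ 0 := gaussSum_ne_zero_of_nontrivial (by rw [ZMod.card]; exact hpE) hX1 hψ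
  have hXq : X ^ q = X := by
    obtain ⟨k, hk⟩ : ∃ k, q = 4 * k + 1 := ⟨q/4, by omega⟩
    have : X ^ q = X ^ (4 * k + 1) := congrArg (fun n : ℕ => X ^ n) hk
    rw [this, pow_add, pow_mul, hX4, one_pow, one_mul, pow_one]
  have hfrob : G ^ q = gaussSum X (ψ.mulShift q) := by
    rw [hG, gaussSum_frob q, hXq, AddChar.pow_mulShift]
  have hshift := gaussSum_mulShift X ψ (Units.mk0 (q : ZMod p) hqp0)
  simp only [Units.val_mk0] at hshift
  have hXs : X (q : ZMod p) = s := by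
    show f (χ q) = s
    rw [hsχ, map_intCast]
  rw [hXs, ← hfrob, ← hG] at hshift
  have hss : (s:E) * s = 1 := by rcases hs with rfl | rfl <;> norm_num
  have hGq : G ^ (q-1) = s := by
    have h1 : G ^ q = G ^ (q-1) * G := by
      rw [← pow_succ]; congr 1; omega
    rw [h1] at hshift
    have h3 : (s : E) * G ^ (q-1) = 1 := by
      apply mul_right_cancel₀ hG0; linear_combination hshift
    linear_combination (s:E) * h3 - G^(q-1) * hss
  apply (algebraMap (ZMod q) E).injective
  rw [map_mul, map_pow, map_pow, map_natCast, map_intCast, ← hGq, ← hg2]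
  show f (jacobiSum χ χ) ^ (q/2) * _ = _
  have a1 : (g^2)^((q-1)/4) = g ^ (q/2) := by rw [← pow_mul]; congr 1; omega
  have a2 : G^(q-1) = (G^2) ^ (q/2) := by rw [← pow_mul]; congr 1; omega
  rw [a1, a2, ← hJ, mul_pow, mul_comm]

theorem arith_part (p : ℕ) [Fact p.Prime] (hp4 : p % 4 = 1) (J : GaussianInt)
    (hJ : J * star J = (p : GaussianInt)) (hre : J.re % 2 = 1) (him : J.im % 2 = 0)
    (t u : ℤ) (htu : t ^ 2 - p * u ^ 2 = -1) :
    ∃ K δ κ : GaussianInt, (K = J ∨ K = star J) ∧ (δ = ⟨0,1⟩ ∨ δ = ⟨0,-1⟩) ∧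
      (⟨t,1⟩ : GaussianInt) = K * δ * κ ^ 2 := by
  have hpp : p.Prime := Fact.out
  have hp0 : (p : GaussianInt) ≠ 0 := by exact_mod_cast hpp.ne_zero
  obtain ⟨m, hm⟩ : ∃ m, t = 2 * m := by
    rcases Int.even_or_odd' t with ⟨m, h | h⟩
    · exact ⟨m, h⟩
    · exfalso
      obtain ⟨k, hk⟩ : ∃ k : ℤ, (p : ℤ) = 4 * k + 1 := ⟨p/4, by omega⟩
      rw [h, hk] at htu
      rcases Int.even_or_odd' u with ⟨n, h' | h'⟩
      · rw [h'] at htu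
        have : 4 * (m^2 + m - (4*k+1)*n^2) = -2 := by linear_combination htu
        omega
      · rw [h'] at htu
        have : 2 * (2*m^2 + 2*m - (4*k+1)*(2*n^2+2*n) - 2 * k) = -1 := by linear_combination htu
        omega
  have hJn : J.norm = p := by
    have h := Zsqrtd.norm_eq_mul_conj J
    rw [hJ] at h
    exact_mod_cast h
  have hirr : Irreducible J := by
    constructor
    · intro h
      rw [← Zsqrtd.norm_eq_one_iff, hJn, Int.natAbs_natCast] at h
      exact hpp.one_lt.ne' h
    · intro x y hxy
      have h : x.norm.natAbs * y.norm.natAbs = p := by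
        rw [← Int.natAbs_mul, ← Zsqrtd.norm_mul, ← hxy, hJn, Int.natAbs_natCast]
      rw [← Zsqrtd.norm_eq_one_iff, ← Zsqrtd.norm_eq_one_iff]
      rcases (Nat.dvd_prime hpp).mp (Dvd.intro _ h) with h1 | h1
      · exact Or.inl h1
      · right
        rw [h1] at h
        exact Nat.eq_of_mul_eq_mul_left hpp.pos (by rw [h, mul_one])
  have hprod : (⟨t,1⟩ : GaussianInt) * ⟨t,-1⟩ = p * (u:GaussianInt)^2 := by
    have e : (⟨t,1⟩ : GaussianInt) * ⟨t,-1⟩ = ((t^2+1 : ℤ) : GaussianInt) := by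
      ext
      · simp [pow_two]
      · simp [pow_two]
    rw [e, show t^2+1 = p * u^2 by linear_combination htu]
    push_cast; ring
  have hst : star (⟨t,1⟩ : GaussianInt) = ⟨t,-1⟩ := by ext <;> simp
  have hst' : star (⟨t,-1⟩ : GaussianInt) = ⟨t,1⟩ := by ext <;> simp
  obtain ⟨K, hK, ν, hν⟩ : ∃ K, (K = J ∨ K = star J) ∧ K ∣ (⟨t,1⟩ : GaussianInt) := by
    have hd : J ∣ (⟨t,1⟩ : GaussianInt) * ⟨t,-1⟩ := by
      rw [hprod, ← hJ, mul_assoc]; exact Dvd.intro _ rfl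
    rcases hirr.prime.dvd_or_dvd hd with h | h
    · exact ⟨J, Or.inl rfl, h⟩
    · refine ⟨star J, Or.inr rfl, ?_⟩
      obtain ⟨c, hc⟩ := h
      exact ⟨star c, by rw [← hst', hc, star_mul, mul_comm]⟩
  have hKK : K * star K = p := by
    rcases hK with rfl | rfl
    · exact hJ
    · rw [star_star, mul_comm]; exact hJ
  have hKre : K.re % 2 = 1 := by rcases hK with rfl | rfl <;> simp [hre]
  have hKim : K.im % 2 = 0 := by rcases hK with rfl | rfl <;> simp <;> omega
  have hν' : (⟨t,-1⟩ : GaussianInt) = star K * star ν := by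
    rw [← hst, hν, star_mul, mul_comm]
  have hνν : ν * star ν = (u : GaussianInt)^2 := by
    apply mul_left_cancel₀ hp0
    rw [← hprod, hν, hν', ← hKK]; ring
  have hcop : IsCoprime (⟨t,1⟩ : GaussianInt) ⟨t,-1⟩ := by
    refine ⟨⟨t,-1⟩ + (m:GaussianInt)^2 * ⟨0,2⟩, -(m:GaussianInt)^2 * ⟨0,2⟩, ?_⟩
    rw [hm]
    ext
    · simp [pow_two]; ring
    · simp [pow_two]; try ring
  rw [hν, hν'] at hcop
  have hcop2 : IsCoprime ν (star ν) := hcop.of_mul_left_right.of_mul_right_right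
  obtain ⟨d, w, hw⟩ := exists_associated_pow_of_mul_eq_pow' hcop2 hνν
  refine ⟨K, w, d, hK, ?_, by rw [hν, ← hw]; ring⟩
  have hwu := (Zsqrtd.norm_eq_one_iff (x := (w : GaussianInt))).mpr w.isUnit
  have him1 : (1:ℤ) = (K * (d^2 * (w:GaussianInt))).im := by rw [hw, ← hν]
  generalize (w : GaussianInt) = W at hwu him1 ⊢
  obtain ⟨a, b⟩ := W
  rw [GaussianInt.natAbs_norm_eq] at hwu
  simp only at hwu
  obtain ⟨k, hk⟩ : ∃ k, K.im = 2 * k := ⟨K.im/2, by omega⟩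
  simp [pow_two] at him1
  rw [hk] at him1
  by_cases hb : b = 0
  · exfalso
    rw [hb] at him1
    have : 1 = 2 * (K.re * (d.re * d.im * a) + k * ((d.re * d.re - d.im * d.im)*a)) := by
      linear_combination him1
    omega
  · have ha : a = 0 := by
      by_contra ha
      have h1 : 0 < a.natAbs := Int.natAbs_pos.mpr ha
      have h2 : 0 < b.natAbs := Int.natAbs_pos.mpr hb
      nlinarith
    rw [ha] at hwu
    have : b.natAbs = 1 := by
      simp at hwu; omega
    rw [ha]
    rcases Int.natAbs_eq_iff.mp this with h | h
    · left; rw [h]; rfl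
    · right; rw [h]; rfl

theorem quarticSym_aux (p : ℕ) [Fact p.Prime] (h2 : p % 4 = 1) (m : ℤ) :
    ((m : ZMod p) ^ ((p - 1) / 4) = 1 → quarticSym p m = 1) ∧
    ((m : ZMod p) ^ ((p - 1) / 4) = -1 → quarticSym p m = -1) := by
  have h1 : (-1 : ZMod p) ≠ 1 := by
    haveI : Fact (2 < p) := ⟨by have := (Fact.out : p.Prime).two_le; omega⟩
    exact ZMod.neg_one_ne_one
  constructor
  · intro h; simp [quarticSym, h]
  · intro h; simp [quarticSym, h, h1]

theorem scholz (p q : ℕ) [Fact p.Prime] [Fact q.Prime] (hne : p ≠ q)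
    (hp4 : p % 4 = 1) (hq4 : q % 4 = 1) (hpq : legendreSym q p = 1)
    (t u : ℤ) (htu : t ^ 2 - p * u ^ 2 = -1)
    (ρ : ZMod q) (hρ : ρ ^ 2 = (p : ZMod q)) :
    quadraticChar (ZMod q) ((t : ZMod q) + (u : ZMod q) * ρ) =
      quarticSym q (p : ℤ) * quarticSym p (q : ℤ) := by
  have hqge := (Fact.out : q.Prime).two_le
  have hpq0 : (p : ZMod q) ≠ 0 := by
    rw [Ne, ZMod.natCast_eq_zero_iff]
    rw [Nat.prime_dvd_prime_iff_eq Fact.out Fact.out]; exact hne.symm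
  have hqp0 : (q : ZMod p) ≠ 0 := by
    rw [Ne, ZMod.natCast_eq_zero_iff]
    rw [Nat.prime_dvd_prime_iff_eq Fact.out Fact.out]; exact hne
  have hqsq : IsSquare (q : ZMod p) := by
    have := ZMod.exists_sq_eq_prime_iff_of_mod_four_eq_one (p := p) (q := q) hp4 (by omega)
    exact this.mpr ⟨ρ, by rw [← hρ, pow_two]⟩
  haveI : Fact (2 < q) := ⟨by omega⟩
  have hneg : (-1 : ZMod q) ≠ 1 := ZMod.neg_one_ne_one
  have h20 : (2 : ZMod q) ≠ 0 := by
    intro h; exact hneg (by linear_combination -h)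
  have hchar : ringChar (ZMod q) ≠ 2 := by rw [ZMod.ringChar_zmod_n]; omega
  obtain ⟨χ, hχ⟩ := exists_char p hp4
  obtain ⟨hre, him⟩ := jac_parity p hp4 χ hχ
  have hJ := jac_norm p χ hχ
  obtain ⟨K, δ, κ, hK, hδ, hfac⟩ := arith_part p hp4 _ hJ hre him t u htu
  -- the value of the quartic symbol of q mod p
  obtain ⟨s, hs, hsχ, hsq⟩ : ∃ s : ℤ, (s = 1 ∨ s = -1) ∧ χ (q : ZMod p) = s ∧
      quarticSym p (q : ℤ) = s := by
    have h := quarticSym_aux p hp4 (q : ℤ)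
    rw [Int.cast_natCast] at h
    rcases char_val p hp4 χ hχ _ hqp0 hqsq with ⟨h1, h2⟩ | ⟨h1, h2⟩
    · exact ⟨1, Or.inl rfl, by rw [h2]; simp, h.1 h1⟩
    · exact ⟨-1, Or.inr rfl, by rw [h2]; simp, h.2 h1⟩
  -- the choice of a square root of -1
  have htuq : (t : ZMod q)^2 - p * (u : ZMod q)^2 = -1 := by
    have := congrArg (Int.cast : ℤ → ZMod q) htu
    push_cast at this; exact this
  obtain ⟨ι, hι, htι⟩ : ∃ ι : ZMod q, ι * ι = -1 ∧ (t : ZMod q) + ι ≠ 0 := by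
    obtain ⟨ι, hι⟩ := (ZMod.exists_sq_eq_neg_one_iff (p := q)).mpr (by omega)
    by_cases h : (t : ZMod q) + ι = 0
    · refine ⟨-ι, by rw [hι]; ring, fun h' => ?_⟩
      have h3 : 2 * ι = 0 := by linear_combination h - h'
      have h4 : ι = 0 := (mul_eq_zero.mp h3).resolve_left h20
      rw [h4] at hι; simp at hι
    · exact ⟨ι, hι.symm, h⟩
  have hι0 : ι ≠ 0 := by rintro rfl; simp at hι
  let φ : GaussianInt →+* ZMod q := Zsqrtd.lift ⟨ι, by rw [hι]; simp⟩
  have hφ : ∀ a b : ℤ, φ ⟨a, b⟩ = a + b * ι := fun a b => rfl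
  have hG := gauss_part p q hne hp4 hq4 χ hχ φ s hs hsχ ρ hρ
  set J := jacobiSum χ χ with hJdef
  set Q := quadraticChar (ZMod q) with hQ
  have hQsq : ∀ x : ZMod q, x ≠ 0 → Q x * Q x = 1 := by
    intro x hx; rw [← pow_two]; exact quadraticChar_sq_one hx
  set ε := (t : ZMod q) + (u : ZMod q) * ρ with hε
  have hεε : ε * (t - u * ρ) = -1 := by
    rw [hε]; linear_combination htuq - (u : ZMod q)^2 * hρ
  have hε0 : ε ≠ 0 := by intro h; rw [h] at hεε; simp at hεε
  have key : 2 * (t + ι) * ε = (t + ι + u * ρ) * (t + ι + u * ρ) := by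
    rw [hε]; linear_combination htuq - hι - (u : ZMod q)^2 * hρ
  have k0 : (t + ι + u * ρ : ZMod q) ≠ 0 := by
    intro h; rw [h, mul_zero] at key
    exact mul_ne_zero (mul_ne_zero h20 htι) hε0 key
  have q1 : Q 2 * Q (t + ι) * Q ε = 1 := by
    rw [← map_mul, ← map_mul, key, map_mul]; exact hQsq _ k0
  have q2 : Q 2 * Q ι = 1 := by
    have e : 2 * ι = (1 + ι) * (1 + ι) := by linear_combination -hι
    have e0 : 1 + ι ≠ 0 := by
      intro h; rw [h, mul_zero] at e; exact mul_ne_zero h20 hι0 e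
    rw [← map_mul, e, map_mul]; exact hQsq _ e0
  have qneg : Q (-1) = 1 := by
    rw [← hι, map_mul]; exact hQsq _ hι0
  have qδ : Q (φ δ) = Q ι := by
    rcases hδ with rfl | rfl
    · rw [hφ]; simp
    · rw [hφ, show (((0:ℤ):ZMod q) + ((-1:ℤ):ZMod q) * ι) = (-1) * ι by push_cast; ring,
        map_mul, qneg, one_mul]
  have hfac' : (t : ZMod q) + ι = φ K * φ δ * φ κ ^ 2 := by
    rw [← map_pow, ← map_mul, ← map_mul, ← hfac, hφ]; simp
  have hκ0 : φ κ ≠ 0 := by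
    intro h; rw [h] at hfac'; apply htι; rw [hfac']; ring
  have q3 : Q (t + ι) = Q (φ K) * Q ι := by
    rw [hfac', map_mul, map_mul, qδ, pow_two, map_mul, hQsq _ hκ0, mul_one]
  have hJJ : φ J * φ (star J) = p := by rw [← map_mul, hJ, map_natCast]
  have hJ0 : φ J ≠ 0 := by intro h; rw [h, zero_mul] at hJJ; exact hpq0 hJJ.symm
  have hρ0 : ρ ≠ 0 := by rintro rfl; apply hpq0; rw [← hρ]; ring
  have qp : Q p = 1 := by rw [← hρ, pow_two, map_mul]; exact hQsq _ hρ0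
  have q4 : Q (φ K) = Q (φ J) := by
    rcases hK with rfl | rfl
    · rfl
    · have e : Q (φ J) * Q (φ (star J)) = 1 := by rw [← map_mul, hJJ, qp]
      have e2 := hQsq _ hJ0
      linear_combination Q (φ J) * e - Q (φ (star J)) * e2
  have q5 : Q ε = Q (φ J) := by
    have e2 := hQsq _ hJ0
    have e3 : Q (φ J) * Q ε = 1 := by
      rw [q3, q4] at q1
      linear_combination q1 - Q (φ J) * Q ε * q2
    linear_combination Q (φ J) * e3 - Q ε * e2
  rw [q5, hsq]
  have hpow : (p : ZMod q) ^ ((q-1)/4) = 1 ∨ (p : ZMod q) ^ ((q-1)/4) = -1 := by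
    have : (p : ZMod q) ^ ((q-1)/4) = ρ ^ (q/2) := by
      rw [← hρ, ← pow_mul]; congr 1; omega
    rw [this]
    exact ZMod.pow_div_two_eq_neg_one_or_one q hρ0
  have hQp := quadraticChar_eq_pow_of_char_ne_two' hchar (φ J)
  rw [ZMod.card] at hQp
  have hd := quadraticChar_dichotomy hJ0
  rw [← hQp] at hG
  have hqs := quarticSym_aux q hq4 (p : ℤ)
  rw [Int.cast_natCast] at hqs
  rcases hpow with h | h <;> rw [h] at hG
  · rw [hqs.1 h]
    rcases hs with rfl | rfl <;> rcases hd with h' | h' <;> rw [h'] at hG <;> simp [hQ, h'] <;>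
      (exfalso; simp [hneg, hneg.symm] at hG)
  · rw [hqs.2 h]
    rcases hs with rfl | rfl <;> rcases hd with h' | h' <;> rw [h'] at hG <;> simp [hQ, h'] <;>
      (exfalso; simp [hneg, hneg.symm] at hG)
end
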